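/- Let a_1, …, a_8 be nonnegative reals satisfying the E_8 inequalities: 2a_1 ≥ a_2; 2a_2 ≥ a_1 + a_3; 2a_3 ≥ a_2 + a_4 + a_5; 2a_4 ≥ a_3; 2a_5 ≥ a_3 + a_6; 2a_6 ≥ a_5 + a_7; 2a_7 ≥ a_6 + a_8; 2a_8 ≥ a_7. Then min(a_1, a_2/2, a_3/3, 2a_4/3, 2a_5/5, a_6/2, 2a_7/3, a_8) = a_8. -/

import Mathlib

theorem stmt9 (a1 a2 a3 a4 a5 a6 a7 a8 : ℝ)
    (hnn : 0 ≤ a1 ∧ 0 ≤ a2 ∧ 0 ≤ a3 ∧ 0 ≤ a4 ∧ 0 ≤ a5 ∧ 0 ≤ a6 ∧ 0 ≤ a7 ∧ 0 ≤ a8)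
    (h1 : 2 * a1 ≥ a2) (h2 : 2 * a2 ≥ a1 + a3) (h3 : 2 * a3 ≥ a2 + a4 + a5)
    (h4 : 2 * a4 ≥ a3) (h5 : 2 * a5 ≥ a3 + a6) (h6 : 2 * a6 ≥ a5 + a7)
    (h7 : 2 * a7 ≥ a6 + a8) (h8 : 2 * a8 ≥ a7) :
    min a1 (min (a2 / 2) (min (a3 / 3) (min (2 * a4 / 3) (min (2 * a5 / 5)
      (min (a6 / 2) (min (2 * a7 / 3) a8)))))) = a8 := by
  have e1 : a8 ≤ a1 := by linarith
  have e2 : a8 ≤ a2 / 2 := by linarith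
  have e3 : a8 ≤ a3 / 3 := by linarith
  have e4 : a8 ≤ 2 * a4 / 3 := by linarith
  have e5 : a8 ≤ 2 * a5 / 5 := by linarith
  have e6 : a8 ≤ a6 / 2 := by linarith
  have e7 : a8 ≤ 2 * a7 / 3 := by linarith
  simp only [min_eq_right e1, min_eq_right e2, min_eq_right e3, min_eq_right e4,
    min_eq_right e5, min_eq_right e6, min_eq_right e7]
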